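/- arXiv:0707.2576 — 2 statements merged into one kernel-verified Lean document; each statement's English description precedes it below -/
import Mathlib

section
/- The weak dual of a 2-connected simple outerplanar graph (with respect to an outerplanar embedding) is a tree. -/
/-- An incidence of `G` is a pair `(v, vw)` with `G.Adj v w`, encoded as the ordered pair
`(v, w)`.  Two incidences `(v, vw)` and `(v', v'w')` are adjacent if `v = v'`, `w = v'`
or `v = w'`.  A `(k, l)`-incidence coloring is a proper coloring of the incidences with at
most `k` colors such that for every vertex `v` at most `l` colors appear on the incoming
incidences `(u, uv)`. -/
def IsIncColoring {V : Type*} (G : SimpleGraph V) (k l : ℕ) (c : V → V → Fin k) : Prop :=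
  (∀ v w v' w' : V, G.Adj v w → G.Adj v' w' → (v, w) ≠ (v', w') →
      (v = v' ∨ w = v' ∨ v = w') → c v w ≠ c v' w') ∧
  (∀ v : V, {x : Fin k | ∃ u, G.Adj u v ∧ c u v = x}.ncard ≤ l)

/-- `G` has a `(k, l)`-incidence coloring. -/
def HasIncColoring {V : Type*} (G : SimpleGraph V) (k l : ℕ) : Prop :=
  ∃ c : V → V → Fin k, IsIncColoring G k l c

/-- A graph is outerplanar iff it has a one-page book embedding: the vertices can be placed
(injectively) on a line so that no two edges interleave. -/
def Outerplanar {V : Type*} (G : SimpleGraph V) : Prop :=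
  ∃ f : V → ℝ, Function.Injective f ∧
    ∀ a b c d : V, G.Adj a b → G.Adj c d →
      ¬(f a < f c ∧ f c < f b ∧ f b < f d)

/-- A rotation system on a finite simple graph: a permutation of the darts fixing sources,
whose restriction to the darts at each vertex is a single cycle (the cyclic rotation of
edges around that vertex). -/
def IsRotationSystem {V : Type*} (G : SimpleGraph V) (rho : Equiv.Perm G.Dart) : Prop :=
  (∀ d : G.Dart, (rho d).fst = d.fst) ∧
    ∀ d d' : G.Dart, d.fst = d'.fst → rho.SameCycle d d'

/-- Reversal of darts, as a permutation. -/
def dartRev {V : Type*} (G : SimpleGraph V) : Equiv.Perm G.Dart :=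
  Function.Involutive.toPerm SimpleGraph.Dart.symm fun d => SimpleGraph.Dart.symm_symm d

/-- The face-tracing permutation of a rotation system: first reverse a dart, then rotate. -/
def facePerm {V : Type*} (G : SimpleGraph V) (rho : Equiv.Perm G.Dart) :
    Equiv.Perm G.Dart :=
  (dartRev G).trans rho

/-- Darts lie on the same face iff they are in the same cycle of the face-tracing
permutation. -/
def faceSetoid {V : Type*} (G : SimpleGraph V) (rho : Equiv.Perm G.Dart) :
    Setoid G.Dart :=
  ⟨(facePerm G rho).SameCycle,
    ⟨fun d => Equiv.Perm.SameCycle.refl _ d, fun h => h.symm, fun h h' => h.trans h'⟩⟩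

/-- The faces of the embedding determined by a rotation system. -/
def Faces {V : Type*} (G : SimpleGraph V) (rho : Equiv.Perm G.Dart) : Type _ :=
  Quotient (faceSetoid G rho)

/-- The weak dual of a plane embedding given by a rotation system rho with outer face o:
vertices are the faces other than o, two faces being adjacent when some edge (dart and its
reverse) separates them. -/
def FaceWeakDual {V : Type*} (G : SimpleGraph V) (rho : Equiv.Perm G.Dart)
    (o : Faces G rho) : SimpleGraph {f : Faces G rho // f ≠ o} :=
  SimpleGraph.fromRel fun f g =>
    ∃ d : G.Dart, Quotient.mk (faceSetoid G rho) d = f.1 ∧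
      Quotient.mk (faceSetoid G rho) d.symm = g.1

/-- The face containing a dart. -/
def dartFace {V : Type*} (G : SimpleGraph V) (rho : Equiv.Perm G.Dart) (d : G.Dart) :
    Faces G rho :=
  Quotient.mk (faceSetoid G rho) d

section RotationSystem

variable {V : Type*} {G : SimpleGraph V} {rho : Equiv.Perm G.Dart}

theorem facePerm_apply (d : G.Dart) : facePerm G rho d = rho d.symm := rfl

theorem dartFace_facePerm (d : G.Dart) :
    dartFace G rho (facePerm G rho d) = dartFace G rho d :=
  Quotient.sound (s := faceSetoid G rho) ((Equiv.Perm.sameCycle_apply_left).2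
    (Equiv.Perm.SameCycle.refl _ d))

theorem dartFace_rho (d : G.Dart) : dartFace G rho (rho d) = dartFace G rho d.symm := by
  have h := dartFace_facePerm (rho := rho) d.symm
  rwa [facePerm_apply, SimpleGraph.Dart.symm_symm] at h

theorem dartFace_surjective : Function.Surjective (dartFace G rho) :=
  Quotient.mk_surjective

instance [Finite G.Dart] : Finite (Faces G rho) :=
  inferInstanceAs (Finite (Quotient (faceSetoid G rho)))

theorem IsRotationSystem.fst_facePerm (hrot : IsRotationSystem G rho) (d : G.Dart) :
    (facePerm G rho d).fst = d.snd := by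
  rw [facePerm_apply, hrot.1]; rfl

theorem IsRotationSystem.fst_pow (hrot : IsRotationSystem G rho) (d : G.Dart) (k : ℕ) :
    ((rho ^ k) d).fst = d.fst := by
  induction k with
  | zero => rfl
  | succ k ih => rw [pow_succ', Equiv.Perm.mul_apply, hrot.1, ih]

/-- A function on darts that is constant along edges and rotations is constant. -/
theorem IsRotationSystem.eq_of_invariant (hrot : IsRotationSystem G rho)
    (hconn : G.Connected) {α : Type*} (y : G.Dart → α) (hsymm : ∀ d, y d.symm = y d)
    (hrho : ∀ d, y (rho d) = y d) (d d' : G.Dart) : y d = y d' := by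
  have hcyc : ∀ a b : G.Dart, a.fst = b.fst → y a = y b := by
    intro a b hab
    obtain ⟨i, rfl⟩ := hrot.2 a b hab
    induction i using Int.induction_on with
    | zero => rfl
    | succ i ih =>
      rw [add_comm, zpow_add, Equiv.Perm.mul_apply, zpow_one, hrho]
      exact ih (by rw [zpow_natCast, hrot.fst_pow])
    | pred i ih =>
      have h1 : a.fst = ((rho ^ (-(i : ℤ))) a).fst := by
        have := hrot.fst_pow ((rho ^ (-(i : ℤ))) a) i
        rw [← zpow_natCast, ← Equiv.Perm.mul_apply, ← zpow_add] at this
        simpa using this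
      rw [ih h1, ← hrho ((rho ^ (-(i : ℤ) - 1)) a), ← Equiv.Perm.mul_apply, ← zpow_one_add]
      congr 3
      ring
  have hwalk : ∀ (u v : V) (_ : G.Walk u v) (a b : G.Dart), a.fst = u → b.fst = v →
      y a = y b := by
    intro u v p
    induction p with
    | nil => intro a b ha hb; exact hcyc a b (ha.trans hb.symm)
    | @cons u w v huw p ih =>
      intro a b ha hb
      let e : G.Dart := ⟨(u, w), huw⟩
      rw [hcyc a e ha, ← hsymm e]
      exact ih e.symm b rfl hb
  obtain ⟨p⟩ := hconn.preconnected d.fst d'.fst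
  exact hwalk _ _ p d d' rfl rfl

end RotationSystem

theorem finrank_le_one_of_forall_eq {ι K : Type*} [Finite ι] [Field K]
    (P : Submodule K (ι → K)) (hP : ∀ y ∈ P, ∀ i j, y i = y j) :
    Module.finrank K P ≤ 1 := by
  have hle : P ≤ Submodule.span K {(1 : ι → K)} := by
    intro y hy
    rw [Submodule.mem_span_singleton]
    rcases isEmpty_or_nonempty ι with h | ⟨⟨i⟩⟩
    · exact ⟨0, Subsingleton.elim _ _⟩
    · refine ⟨y i, ?_⟩
      ext j
      simp [hP y hy i j]
  refine (Submodule.finrank_mono hle).trans ?_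
  simpa using finrank_span_le_card (R := K) ({(1 : ι → K)} : Set (ι → K))

/-- Summing over a face is invariant under tracing the face. -/
theorem sum_facePerm {V : Type*} {G : SimpleGraph V} {rho : Equiv.Perm G.Dart}
    [Fintype G.Dart] [DecidableEq (Faces G rho)] {M : Type*} [AddCommMonoid M]
    (x : G.Dart → M) (f : Faces G rho) :
    ∑ d with dartFace G rho d = f, x (facePerm G rho d) =
      ∑ d with dartFace G rho d = f, x d := by
  rw [Finset.sum_filter, Finset.sum_filter, ← Equiv.sum_comp (facePerm G rho)
    (fun d => if dartFace G rho d = f then x d else 0)]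
  simp only [dartFace_facePerm]

/-- On a connected plane map, a mod 2 edge cochain whose sum around every face vanishes is
the coboundary of a vertex function. -/
theorem exists_potential_of_planar {V : Type*} [Fintype V] [DecidableEq V]
    {G : SimpleGraph V} [DecidableRel G.Adj] (hconn : G.Connected)
    {rho : Equiv.Perm G.Dart} [DecidableEq (Faces G rho)] (hrot : IsRotationSystem G rho)
    (hplane : 2 * (Fintype.card V : ℤ) - Nat.card G.Dart + 2 * Nat.card (Faces G rho) = 4)
    (x : G.Dart → ZMod 2) (hsymm : ∀ d, x d.symm = x d)
    (hface : ∀ f : Faces G rho, ∑ d with dartFace G rho d = f, x d = 0) :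
    ∃ h : V → ZMod 2, ∀ d : G.Dart, x d = h d.fst + h d.snd := by
  classical
  have : Fintype (Faces G rho) := Fintype.ofFinite _
  have : Fact (Nat.Prime 2) := ⟨Nat.prime_two⟩
  let ed : G.Dart → G.edgeSet := fun d => ⟨d.edge, d.edge_mem⟩
  have hed : ∀ d, ed d.symm = ed d := fun d => Subtype.ext d.edge_symm
  have hedeq : ∀ a b, ed a = ed b → a = b ∨ a = b.symm := fun a b h =>
    (SimpleGraph.dart_edge_eq_iff a b).1 (congrArg Subtype.val h)
  have hsurj : Function.Surjective ed := by
    rintro ⟨s, hs⟩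
    induction s using Sym2.ind with
    | _ a b => exact ⟨⟨(a, b), hs⟩, rfl⟩
  choose sec hsec using hsurj
  have hdescend : ∀ z : G.Dart → ZMod 2, (∀ d, z d.symm = z d) → ∀ d, z (sec (ed d)) = z d := by
    intro z hz d
    rcases hedeq _ _ (hsec (ed d)) with h | h
    · rw [h]
    · rw [h, hz]
  let M : Matrix (Faces G rho) G.edgeSet (ZMod 2) := Matrix.of fun f s =>
    ∑ d with dartFace G rho d = f, if ed d = s then 1 else 0
  have hM : ∀ z f, M.mulVecLin z f = ∑ d with dartFace G rho d = f, z (ed d) := by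
    intro z f
    simp only [Matrix.mulVecLin_apply, Matrix.mulVec, dotProduct, M, Matrix.of_apply,
      Finset.sum_mul]
    rw [Finset.sum_comm]
    simp
  have hMt : ∀ y d, M.transpose.mulVecLin y (ed d) =
      y (dartFace G rho d) + y (dartFace G rho d.symm) := by
    intro y d
    simp only [Matrix.mulVecLin_apply, Matrix.mulVec, dotProduct, M, Matrix.of_apply,
      Finset.sum_mul, Matrix.transpose_apply, Finset.sum_filter]
    rw [Finset.sum_comm]
    have : ∀ e : G.Dart, (∑ f, (if dartFace G rho e = f then
        if ed e = ed d then (1 : ZMod 2) else 0 else 0) * y f) =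
        if e = d ∨ e = d.symm then y (dartFace G rho e) else 0 := by
      intro e
      have hiff : ed e = ed d ↔ e = d ∨ e = d.symm :=
        ⟨hedeq e d, by rintro (rfl | rfl); exacts [rfl, hed _]⟩
      simp [hiff]
    refine (Finset.sum_congr rfl fun e _ => this e).trans ?_
    rw [← Finset.sum_filter]
    have hset : Finset.univ.filter (fun e => e = d ∨ e = d.symm) = {d, d.symm} := by
      ext e; simp
    rw [hset, Finset.sum_pair d.symm_ne.symm]
  let N : (V → ZMod 2) →ₗ[ZMod 2] (G.edgeSet → ZMod 2) :=
    { toFun := fun h s => h (sec s).fst + h (sec s).snd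
      map_add' := by intro a b; ext s; simp only [Pi.add_apply]; ring
      map_smul' := by intro a b; ext s; simp [mul_add] }
  have hN : ∀ h d, N h (ed d) = h d.fst + h d.snd := fun h d =>
    hdescend (fun d => h d.fst + h d.snd) (fun d => add_comm _ _) d
  have hkerN : Module.finrank (ZMod 2) (LinearMap.ker N) ≤ 1 := by
    refine finrank_le_one_of_forall_eq _ fun y hy => ?_
    have hadj : ∀ u v, G.Adj u v → y u = y v := by
      intro u v huv
      have := hN y ⟨(u, v), huv⟩
      rw [LinearMap.mem_ker.1 hy] at this
      exact CharTwo.add_eq_zero.1 this.symm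
    intro i j
    obtain ⟨p⟩ := hconn.preconnected i j
    induction p with
    | nil => rfl
    | cons huv _ ih => exact (hadj _ _ huv).trans ih
  have hkerM : Module.finrank (ZMod 2) (LinearMap.ker M.transpose.mulVecLin) ≤ 1 := by
    refine finrank_le_one_of_forall_eq _ fun y hy => ?_
    have hyd : ∀ d, y (dartFace G rho d.symm) = y (dartFace G rho d) := by
      intro d
      have := hMt y d
      rw [LinearMap.mem_ker.1 hy] at this
      exact (CharTwo.add_eq_zero.1 this.symm).symm
    intro i j
    obtain ⟨d, rfl⟩ := dartFace_surjective i
    obtain ⟨d', rfl⟩ := dartFace_surjective j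
    exact hrot.eq_of_invariant hconn (fun d => y (dartFace G rho d)) hyd
      (fun d => by rw [dartFace_rho, hyd]) d d'
  have hle : LinearMap.range N ≤ LinearMap.ker M.mulVecLin := by
    rintro _ ⟨h, rfl⟩
    rw [LinearMap.mem_ker]
    ext f
    rw [hM]
    simp only [hN, Finset.sum_add_distrib, ← hrot.fst_facePerm]
    rw [sum_facePerm (fun d => h d.fst)]
    exact CharTwo.add_self_eq_zero _
  have hrank : Module.finrank (ZMod 2) (LinearMap.range M.transpose.mulVecLin) =
      Module.finrank (ZMod 2) (LinearMap.range M.mulVecLin) := M.rank_transpose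
  have h1 := LinearMap.finrank_range_add_finrank_ker N
  have h2 := LinearMap.finrank_range_add_finrank_ker M.mulVecLin
  have h3 := LinearMap.finrank_range_add_finrank_ker M.transpose.mulVecLin
  have hE : Fintype.card G.Dart = 2 * Fintype.card G.edgeSet := by
    rw [G.dart_card_eq_twice_card_edges, SimpleGraph.edgeFinset_card]
  rw [Module.finrank_fintype_fun_eq_card] at h1 h2 h3
  rw [Nat.card_eq_fintype_card, Nat.card_eq_fintype_card] at hplane
  have heq : LinearMap.range N = LinearMap.ker M.mulVecLin :=
    Submodule.eq_of_le_of_finrank_le hle (by omega)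
  have hx : (fun s => x (sec s)) ∈ LinearMap.ker M.mulVecLin := by
    rw [LinearMap.mem_ker]
    ext f
    rw [hM]
    simp only [hdescend x hsymm]
    exact hface f
  rw [← heq] at hx
  obtain ⟨h, hh⟩ := hx
  refine ⟨h, fun d => ?_⟩
  rw [← hN, hh]
  exact (hdescend x hsymm d).symm

/-- In a 2-connected plane map, a face passes at most once through each vertex. -/
theorem eq_of_fst_eq_of_dartFace_eq {V : Type*} [Fintype V] [DecidableEq V]
    {G : SimpleGraph V} [DecidableRel G.Adj] (hconn : G.Connected)
    (h2conn : ∀ u : V, (G.induce {x | x ≠ u}).Connected)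
    {rho : Equiv.Perm G.Dart} (hrot : IsRotationSystem G rho)
    (hplane : 2 * (Fintype.card V : ℤ) - Nat.card G.Dart + 2 * Nat.card (Faces G rho) = 4)
    {d d' : G.Dart} (hfst : d.fst = d'.fst)
    (hface : dartFace G rho d = dartFace G rho d') : d = d' := by
  classical
  by_contra hne
  obtain ⟨k, rfl⟩ := (hrot.2 d d' hfst).exists_nat_pow_eq
  let a : G.Dart → ZMod 2 := fun e => ∑ i ∈ Finset.range k, if e = (rho ^ i) d then 1 else 0
  have ha : ∀ e, e.fst ≠ d.fst → a e = 0 := by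
    intro e he
    refine Finset.sum_eq_zero fun i _ => if_neg ?_
    rintro rfl
    exact he (hrot.fst_pow d i)
  have htel : ∀ e, a (rho e) + a e =
      (if rho e = d then 1 else 0) + if rho e = (rho ^ k) d then 1 else 0 := by
    intro e
    have hshift : a e = ∑ i ∈ Finset.range k, if rho e = (rho ^ (i + 1)) d then 1 else 0 := by
      refine Finset.sum_congr rfl fun i _ => ?_
      simp only [pow_succ', Equiv.Perm.mul_apply, rho.injective.eq_iff]
    have h1 := Finset.sum_range_succ (fun i => if rho e = (rho ^ i) d then (1 : ZMod 2) else 0) k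
    have h2 := Finset.sum_range_succ' (fun i => if rho e = (rho ^ i) d then (1 : ZMod 2) else 0) k
    rw [h1] at h2
    rw [← hshift] at h2
    change a (rho e) + _ = a e + _ at h2
    rw [pow_zero, Equiv.Perm.one_apply] at h2
    generalize a (rho e) = p at *
    generalize a e = q at *
    generalize (if rho e = (rho ^ k) d then (1 : ZMod 2) else 0) = r at *
    generalize (if rho e = d then (1 : ZMod 2) else 0) = s at *
    clear * - h2
    decide +revert
  obtain ⟨h, hh⟩ := exists_potential_of_planar hconn hrot hplane
    (fun e => a e + a e.symm) (fun e => by rw [e.symm_symm, add_comm]) (by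
      intro f
      rw [Finset.sum_add_distrib, ← sum_facePerm (rho := rho) a f, ← Finset.sum_add_distrib]
      refine (Finset.sum_congr rfl fun e _ => htel e.symm).trans ?_
      have := sum_facePerm (rho := rho) (fun e => (if e = d then (1 : ZMod 2) else 0) +
        if e = (rho ^ k) d then 1 else 0) f
      refine this.trans ?_
      rw [Finset.sum_add_distrib, Finset.sum_ite_eq', Finset.sum_ite_eq']
      simp only [Finset.mem_filter, Finset.mem_univ, true_and, ← hface]
      exact CharTwo.add_self_eq_zero _)
  have hconst : ∀ p q : {x | x ≠ d.fst}, h p = h q := by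
    intro p q
    obtain ⟨w⟩ := (h2conn d.fst).preconnected p q
    induction w with
    | nil => rfl
    | @cons u v _ huv _ ih =>
      refine Eq.trans ?_ ih
      have := hh ⟨(u.1, v.1), huv⟩
      rw [ha ⟨(u.1, v.1), huv⟩ u.2, ha (SimpleGraph.Dart.symm ⟨(u.1, v.1), huv⟩) v.2,
        add_zero] at this
      exact CharTwo.add_eq_zero.1 this.symm
  have hat : ∀ e : G.Dart, e.fst = d.fst → a e = h d.fst + h e.snd := by
    intro e he
    have hsnd : e.snd ≠ d.fst := fun h => e.fst_ne_snd (he.trans h.symm)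
    rw [← he, ← hh e, ha e.symm hsnd, add_zero]
  set e := rho.symm d with hedef
  have hre : rho e = d := rho.apply_symm_apply d
  have hef : e.fst = d.fst := by rw [← hrot.1 e, hre]
  have hsum := htel e
  rw [hre, if_pos rfl, if_neg hne, hat e hef, hat d rfl,
    hconst ⟨e.snd, fun h => e.fst_ne_snd (hef.trans h.symm)⟩
      ⟨d.snd, d.fst_ne_snd.symm⟩, CharTwo.add_self_eq_zero] at hsum
  exact absurd hsum (by decide)

/-- A 2-connected graph has no vertex of degree one. -/
theorem rho_ne_self {V : Type*} [Fintype V] {G : SimpleGraph V}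
    (hcard : 3 ≤ Fintype.card V) (h2conn : ∀ u : V, (G.induce {x | x ≠ u}).Connected)
    {rho : Equiv.Perm G.Dart} (hrot : IsRotationSystem G rho) (d : G.Dart) : rho d ≠ d := by
  classical
  intro hfix
  have huniq : ∀ w, G.Adj d.fst w → w = d.snd := by
    intro w hw
    obtain ⟨i, hi⟩ := hrot.2 d ⟨(d.fst, w), hw⟩ rfl
    rw [Equiv.Perm.zpow_apply_eq_self_of_apply_eq_self hfix] at hi
    exact (congrArg (fun e : G.Dart => e.snd) hi).symm
  obtain ⟨w, hw1, hw2⟩ : ∃ w, w ≠ d.fst ∧ w ≠ d.snd := by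
    obtain ⟨w, hw⟩ := Finset.exists_mem_notMem_of_card_lt_card
      (s := {d.fst, d.snd}) (t := (Finset.univ : Finset V))
      (lt_of_le_of_lt Finset.card_le_two (by rw [Finset.card_univ]; omega))
    exact ⟨w, by simpa using hw⟩
  have : Nontrivial {x | x ≠ d.snd} :=
    ⟨⟨⟨d.fst, d.fst_ne_snd⟩, ⟨w, hw2⟩, fun h => hw1 (congrArg Subtype.val h).symm⟩⟩
  obtain ⟨v, hv⟩ := (h2conn d.snd).preconnected.exists_adj_of_nontrivial ⟨d.fst, d.fst_ne_snd⟩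
  exact v.2 (huniq v.1 hv)

section WeakDual

variable {V : Type*} {G : SimpleGraph V} {rho : Equiv.Perm G.Dart} {o : Faces G rho}

/-- Both darts lie on bounded faces, and these are joined in the weak dual. -/
def InnerJoined (o : Faces G rho) (a b : G.Dart) : Prop :=
  ∃ (ha : dartFace G rho a ≠ o) (hb : dartFace G rho b ≠ o),
    (FaceWeakDual G rho o).Reachable ⟨_, ha⟩ ⟨_, hb⟩

theorem InnerJoined.symm {a b : G.Dart} (h : InnerJoined o a b) : InnerJoined o b a :=
  ⟨h.2.1, h.1, h.2.2.symm⟩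

theorem InnerJoined.trans {a b c : G.Dart} (h : InnerJoined o a b) (h' : InnerJoined o b c) :
    InnerJoined o a c :=
  ⟨h.1, h'.2.1, h.2.2.trans h'.2.2⟩

theorem InnerJoined.of_dartFace_eq {a b : G.Dart} (ha : dartFace G rho a ≠ o)
    (h : dartFace G rho a = dartFace G rho b) : InnerJoined o a b := by
  refine ⟨ha, h ▸ ha, ?_⟩
  simp only [h]
  exact SimpleGraph.Reachable.refl _

theorem InnerJoined.of_symm {a : G.Dart} (ha : dartFace G rho a ≠ o)
    (hb : dartFace G rho a.symm ≠ o) : InnerJoined o a a.symm := by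
  by_cases h : dartFace G rho a = dartFace G rho a.symm
  · exact .of_dartFace_eq ha h
  · refine ⟨ha, hb, SimpleGraph.Adj.reachable ?_⟩
    rw [FaceWeakDual, SimpleGraph.fromRel_adj]
    exact ⟨fun h' => h (congrArg Subtype.val h'), Or.inl ⟨a, rfl, rfl⟩⟩

theorem innerJoined_of_fst_eq [Finite G.Dart] (hrot : IsRotationSystem G rho)
    (houter : ∀ v : V, ∃ d : G.Dart, d.fst = v ∧ dartFace G rho d = o)
    (honce : ∀ d d' : G.Dart, d.fst = d'.fst → dartFace G rho d = o →
      dartFace G rho d' = o → d = d')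
    {a b : G.Dart} (hab : a.fst = b.fst) (ha : dartFace G rho a ≠ o)
    (hb : dartFace G rho b ≠ o) : InnerJoined o a b := by
  obtain ⟨g, hgv, hg⟩ := houter a.fst
  have key : ∀ k : ℕ, dartFace G rho ((rho ^ k) g) ≠ o →
      InnerJoined o (rho g) ((rho ^ k) g) := by
    intro k
    induction k with
    | zero => exact fun h => absurd hg h
    | succ k ih =>
      intro h
      rw [pow_succ', Equiv.Perm.mul_apply] at h ⊢
      by_cases hk : dartFace G rho ((rho ^ k) g) = o
      · rw [← honce g _ (hrot.fst_pow g k).symm hg hk] at h ⊢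
        exact .of_dartFace_eq h rfl
      · have h' := h
        rw [dartFace_rho] at h'
        exact ((ih hk).trans (.of_symm hk h')).trans (.of_dartFace_eq h' (dartFace_rho _).symm)
  obtain ⟨i, rfl⟩ := (hrot.2 g a hgv).exists_nat_pow_eq
  obtain ⟨j, rfl⟩ := (hrot.2 g b (hgv.trans hab)).exists_nat_pow_eq
  exact (key i ha).symm.trans (key j hb)

theorem faceWeakDual_connected [Finite G.Dart] (hconn : G.Connected)
    (hrot : IsRotationSystem G rho)
    (houter : ∀ v : V, ∃ d : G.Dart, d.fst = v ∧ dartFace G rho d = o)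
    (honce : ∀ d d' : G.Dart, d.fst = d'.fst → dartFace G rho d = o →
      dartFace G rho d' = o → d = d')
    (hside : ∀ d : G.Dart, dartFace G rho d = o → dartFace G rho d.symm ≠ o) :
    (FaceWeakDual G rho o).Connected := by
  have hwalk : ∀ (u v : V) (_ : G.Walk u v) (a b : G.Dart), a.fst = u → b.fst = v →
      dartFace G rho a ≠ o → dartFace G rho b ≠ o → InnerJoined o a b := by
    intro u v p
    induction p with
    | nil =>
      intro a b ha hb
      exact innerJoined_of_fst_eq hrot houter honce (ha.trans hb.symm)
    | @cons u w v huw p ih =>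
      intro a b hau hbv ha hb
      have hstep : ∃ c c' : G.Dart, c.fst = u ∧ c'.fst = w ∧ InnerJoined o c c' := by
        let e : G.Dart := ⟨(u, w), huw⟩
        by_cases he : dartFace G rho e = o
        · exact ⟨facePerm G rho e.symm, e.symm, hrot.fst_facePerm _, rfl,
            (InnerJoined.of_dartFace_eq (hside e he) (dartFace_facePerm _).symm).symm⟩
        · exact ⟨e, facePerm G rho e, rfl, hrot.fst_facePerm _,
            .of_dartFace_eq he (dartFace_facePerm _).symm⟩
      obtain ⟨c, c', hc, hc', hcc⟩ := hstep
      exact ((innerJoined_of_fst_eq hrot houter honce (hau.trans hc.symm) ha hcc.1).trans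
        hcc).trans (ih c' b hc' hbv hcc.2.1 hb)
  rw [SimpleGraph.connected_iff]
  constructor
  · rintro ⟨f, hf⟩ ⟨g, hg⟩
    obtain ⟨a, rfl⟩ := dartFace_surjective f
    obtain ⟨b, rfl⟩ := dartFace_surjective g
    obtain ⟨p⟩ := hconn.preconnected a.fst b.fst
    exact (hwalk _ _ p a b rfl rfl hf hg).2.2
  · obtain ⟨d, hd⟩ := dartFace_surjective o
    exact ⟨⟨_, hside d hd⟩⟩

theorem exists_dart_of_faceWeakDual_adj {f g : {f : Faces G rho // f ≠ o}}
    (h : (FaceWeakDual G rho o).Adj f g) :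
    ∃ d : G.Dart, dartFace G rho d = f.1 ∧ dartFace G rho d.symm = g.1 := by
  rw [FaceWeakDual, SimpleGraph.fromRel_adj] at h
  rcases h.2 with ⟨d, h1, h2⟩ | ⟨d, h1, h2⟩
  · exact ⟨d, h1, h2⟩
  · exact ⟨d.symm, h2, by rw [d.symm_symm]; exact h1⟩

/-- Every dart of the weak dual comes from a dart of `G` with bounded faces on both sides,
so the outer face and its reversal account for the missing darts. -/
theorem card_faceWeakDual_edgeSet_add_card_le [Fintype V] [Finite G.Dart]
    (houter : ∀ v : V, ∃ d : G.Dart, d.fst = v ∧ dartFace G rho d = o)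
    (hside : ∀ d : G.Dart, dartFace G rho d = o → dartFace G rho d.symm ≠ o) :
    2 * Nat.card (FaceWeakDual G rho o).edgeSet + 2 * Fintype.card V ≤ Nat.card G.Dart := by
  classical
  have : Fintype G.Dart := Fintype.ofFinite _
  have : Fintype {f : Faces G rho // f ≠ o} := Fintype.ofFinite _
  choose t ht hto using houter
  choose s hs hs' using fun w : (FaceWeakDual G rho o).Dart =>
    exists_dart_of_faceWeakDual_adj w.adj
  have htinj : ∀ u v, t u = t v → u = v := fun u v h => by rw [← ht u, h, ht v]
  let φ : (FaceWeakDual G rho o).Dart ⊕ (V ⊕ V) → G.Dart :=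
    Sum.elim s (Sum.elim t fun v => (t v).symm)
  have hφ : Function.Injective φ := by
    refine Function.Injective.sumElim ?_ (Function.Injective.sumElim htinj ?_ ?_) ?_
    · intro w w' h
      refine SimpleGraph.Dart.ext _ _ (Prod.ext (Subtype.ext ?_) (Subtype.ext ?_))
      · exact (hs w).symm.trans ((congrArg _ h).trans (hs w'))
      · exact (hs' w).symm.trans ((congrArg (fun e => dartFace G rho e.symm) h).trans (hs' w'))
    · intro u v h
      exact htinj u v (SimpleGraph.Dart.symm_involutive.injective h)
    · intro u v h
      exact hside _ (hto v) (h ▸ hto u)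
    · rintro w (v | v) h
      · exact w.fst.2 ((hs w).symm.trans ((congrArg _ h).trans (hto v)))
      · refine w.snd.2 ((hs' w).symm.trans ((congrArg (fun e => dartFace G rho e.symm) h).trans ?_))
        simpa using hto v
  have hc := Fintype.card_le_of_injective φ hφ
  rw [Fintype.card_sum, Fintype.card_sum, SimpleGraph.dart_card_eq_twice_card_edges,
    SimpleGraph.edgeFinset_card] at hc
  rw [Nat.card_eq_fintype_card, Nat.card_eq_fintype_card]
  omega

end WeakDual


/-- The weak dual of a 2-connected outerplanar graph, with respect to an outerplanar
embedding (a rotation system satisfying Euler's formula for the plane, having a face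
incident to every vertex), is a tree. -/
theorem stmt_13 {V : Type*} [Fintype V] [DecidableEq V] (G : SimpleGraph V)
    [DecidableRel G.Adj]
    (hcard : 3 ≤ Fintype.card V) (hconn : G.Connected)
    (h2conn : ∀ u : V, (G.induce {x | x ≠ u}).Connected)
    (rho : Equiv.Perm G.Dart) (hrot : IsRotationSystem G rho)
    (hplane : 2 * (Fintype.card V : ℤ) - Nat.card G.Dart + 2 * Nat.card (Faces G rho) = 4)
    (o : Faces G rho)
    (houter : ∀ v : V, ∃ d : G.Dart, d.fst = v ∧ Quotient.mk (faceSetoid G rho) d = o) :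
    (FaceWeakDual G rho o).IsTree := by
  classical
  have honce : ∀ d d' : G.Dart, d.fst = d'.fst → dartFace G rho d = o →
      dartFace G rho d' = o → d = d' := fun d d' hfst hd hd' =>
    eq_of_fst_eq_of_dartFace_eq hconn h2conn hrot hplane hfst (hd.trans hd'.symm)
  have hside : ∀ d : G.Dart, dartFace G rho d = o → dartFace G rho d.symm ≠ o :=
    fun d hd hd' => rho_ne_self hcard h2conn hrot d
      (honce _ _ (hrot.1 d) ((dartFace_rho d).trans hd') hd)
  have hc := faceWeakDual_connected hconn hrot houter honce hside
  have hle := card_faceWeakDual_edgeSet_add_card_le houter hside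
  have hge := hc.card_vert_le_card_edgeSet_add_one
  have : Fintype (Faces G rho) := Fintype.ofFinite _
  have hverts : Nat.card {f : Faces G rho // f ≠ o} + 1 = Nat.card (Faces G rho) := by
    have : 0 < Fintype.card (Faces G rho) := Fintype.card_pos_iff.2 ⟨o⟩
    rw [Nat.card_eq_fintype_card, Nat.card_eq_fintype_card, Fintype.card_subtype_compl,
      Fintype.card_subtype_eq]
    omega
  rw [SimpleGraph.isTree_iff_connected_and_card]
  exact ⟨hc, by omega⟩
end

section
/- Every simple planar graph with maximum degree Δ has incidence chromatic number at most Δ + 9. -/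
/-- A proper incidence coloring of G with k colors: adjacent incidences get different
colors.  (The incidence chromatic number of G is at most k iff such a coloring exists.) -/
def HasProperIncColoring {V : Type*} (G : SimpleGraph V) (k : ℕ) : Prop :=
  ∃ c : V → V → Fin k, ∀ v w v' w' : V, G.Adj v w → G.Adj v' w' → (v, w) ≠ (v', w') →
    (v = v' ∨ w = v' ∨ v = w') → c v w ≠ c v' w'

/-- A planar embedding of G: an injective placement of the vertices in the plane together
with an arc for each dart (both darts of an edge tracing the same curve), such that arcs
are injective continuous paths between the endpoints, the only vertices on an arc are its
endpoints, and arcs of distinct edges meet only at vertices. -/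
def IsPlanarEmbedding {V : Type*} (G : SimpleGraph V) (f : V → ℝ × ℝ)
    (arc : G.Dart → Set.Icc (0 : ℝ) 1 → ℝ × ℝ) : Prop :=
  Function.Injective f ∧
  (∀ d, Continuous (arc d)) ∧
  (∀ d, Function.Injective (arc d)) ∧
  (∀ d : G.Dart, arc d ⟨0, by norm_num⟩ = f d.fst ∧ arc d ⟨1, by norm_num⟩ = f d.snd) ∧
  (∀ d : G.Dart, Set.range (arc d.symm) = Set.range (arc d)) ∧
  (∀ d : G.Dart, ∀ v : V, f v ∈ Set.range (arc d) → v = d.fst ∨ v = d.snd) ∧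
  (∀ d e : G.Dart, d.edge ≠ e.edge →
    Set.range (arc d) ∩ Set.range (arc e) ⊆ Set.range f)

/-- A graph is planar if it admits a planar embedding. -/
def Planar {V : Type*} (G : SimpleGraph V) : Prop :=
  ∃ f arc, IsPlanarEmbedding G f arc

section

open unitInterval

/-- A nowhere vanishing path in the complex plane has a continuous logarithm. -/
theorem exists_log_of_path (h : C(I, ℂ)) (h0 : ∀ t, h t ≠ 0) :
    ∃ L : C(I, ℂ), ∀ t, Complex.exp (L t) = h t := by
  let h' : C(I, {z : ℂ // z ≠ 0}) := ⟨fun t => ⟨h t, h0 t⟩, by fun_prop⟩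
  obtain ⟨L, hL, -⟩ := Complex.isCoveringMap_exp.exists_path_lifts h' (Complex.log (h 0))
    (Subtype.ext (Complex.exp_log (h0 0)).symm)
  exact ⟨L, fun t => congrArg Subtype.val (congrFun hL t)⟩

/-- A nowhere vanishing map from the square to the complex plane has a continuous logarithm. -/
theorem exists_log_of_square (h : C(I × I, ℂ)) (h0 : ∀ t, h t ≠ 0) :
    ∃ L : C(I × I, ℂ), ∀ t, Complex.exp (L t) = h t := by
  let h' : C(I × I, {z : ℂ // z ≠ 0}) := ⟨fun t => ⟨h t, h0 t⟩, by fun_prop⟩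
  obtain ⟨f, hf⟩ := exists_log_of_path (h.comp ⟨fun t => (0, t), by fun_prop⟩) (fun t => h0 _)
  have hf' : ∀ a, h' (0, a) = ⟨_, Complex.exp_ne_zero (f a)⟩ :=
    fun a => Subtype.ext (hf a).symm
  exact ⟨Complex.isCoveringMap_exp.liftHomotopy h' f hf', fun t => congrArg Subtype.val
    (congrFun (Complex.isCoveringMap_exp.liftHomotopy_lifts h' f hf') t)⟩

/-- The increment of a continuous logarithm along a path depends only on the path up to a
nonzero constant factor. -/
theorem log_increment_unique {L L' : I → ℂ} (hL : Continuous L) (hL' : Continuous L') (c : ℂ)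
    (h : ∀ t, Complex.exp (L t) = c * Complex.exp (L' t)) : L 1 - L 0 = L' 1 - L' 0 := by
  have key : L = fun t => L' t + (L 0 - L' 0) := by
    refine Complex.isCoveringMap_exp.eq_of_comp_eq hL (by fun_prop) ?_ 0 (by simp)
    funext t
    apply Subtype.ext
    simp only [Function.comp, Complex.exp_add, Complex.exp_sub, h]
    field_simp [Complex.exp_ne_zero]
  have := congrFun key 1
  rw [this]
  ring

/-- Five points in the plane cannot be joined by paths so that the paths joining disjoint pairs
are disjoint. -/
theorem no_five_points (p : Fin 5 → ℂ) (γ : ∀ i j, i ≠ j → Path (p i) (p j))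
    (hγ : ∀ i j k l (hij : i ≠ j) (hkl : k ≠ l), i ≠ k → i ≠ l → j ≠ k → j ≠ l →
      ∀ s t, γ i j hij s ≠ γ k l hkl t) : False := by
  have avoid : ∀ k i j (hij : i ≠ j), k ≠ i → k ≠ j → ∀ s, γ i j hij s - p k ≠ 0 := by
    intro k i j hij hki hkj s
    obtain ⟨m, hmi, hmj, hmk⟩ : ∃ m : Fin 5, m ≠ i ∧ m ≠ j ∧ m ≠ k := by
      clear hγ; revert k i j; decide
    have := hγ i j k m hij hmk.symm hki.symm hmi.symm hkj.symm hmj.symm s 0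
    simpa [sub_eq_zero] using this
  have hp : ∀ i j, i ≠ j → p i - p j ≠ 0 := by
    intro i j hij
    obtain ⟨m, hmi, hmj⟩ : ∃ m : Fin 5, m ≠ i ∧ m ≠ j := by
      clear hγ avoid; revert i j; decide
    simpa using avoid j i m hmi.symm hij.symm hmj.symm 0
  have hlog : ∀ k i j (hij : i ≠ j), k ≠ i → k ≠ j →
      ∃ L : C(I, ℂ), ∀ t, Complex.exp (L t) = γ i j hij t - p k := by
    intro k i j hij hki hkj
    exact exists_log_of_path ⟨fun t => γ i j hij t - p k, by fun_prop⟩ (avoid k i j hij hki hkj)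
  choose L hL using hlog
  let a : Fin 5 → Fin 5 → ℂ := fun k i =>
    if k < i then Complex.log (p i - p k) else Complex.log (p k - p i) + Real.pi * Complex.I
  let e : Fin 5 → Fin 5 → ℤ := fun x y => if y < x then 1 else -1
  have ha : ∀ k i, k ≠ i → Complex.exp (a k i) = p i - p k := by
    intro k i hki
    simp only [a]
    split_ifs
    · exact Complex.exp_log (hp _ _ hki.symm)
    · rw [Complex.exp_add, Complex.exp_log (hp _ _ hki), Complex.exp_pi_mul_I]; ring
  have hae : ∀ x y, x ≠ y → a x y - a y x = Real.pi * Complex.I * e x y := by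
    intro x y hxy
    simp only [a, e]
    rcases lt_or_gt_of_ne hxy with h | h
    · simp [h, h.not_gt]
    · simp [h, h.not_gt]
  have hn : ∀ k i j (hij : i ≠ j) (hki : k ≠ i) (hkj : k ≠ j), ∃ n : ℤ,
      L k i j hij hki hkj 1 - L k i j hij hki hkj 0
        = a k j - a k i + n * (2 * Real.pi * Complex.I) := by
    intro k i j hij hki hkj
    apply Complex.exp_eq_exp_iff_exists_int.mp
    rw [Complex.exp_sub, Complex.exp_sub, hL, hL, ha _ _ hki, ha _ _ hkj]
    simp
  choose n hn using hn
  have main : ∀ i j k l (hij : i ≠ j) (hkl : k ≠ l) (hik : i ≠ k) (hil : i ≠ l)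
      (hjk : j ≠ k) (hjl : j ≠ l),
      2 * (n k i j hij hik.symm hjk.symm - n l i j hij hil.symm hjl.symm
        - n i k l hkl hik hil + n j k l hkl hjk hjl) = e i l - e i k - e j l + e j k := by
    intro i j k l hij hkl hik hil hjk hjl
    obtain ⟨M, hM⟩ := exists_log_of_square
      ⟨fun t => γ i j hij t.1 - γ k l hkl t.2, by fun_prop⟩
      (fun t => sub_ne_zero.mpr (hγ i j k l hij hkl hik hil hjk hjl t.1 t.2))
    simp only [ContinuousMap.coe_mk] at hM
    have h1 := log_increment_unique (L := fun t => M (t, 0)) (L' := L k i j hij hik.symm hjk.symm)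
      (by fun_prop) (by fun_prop) 1 (fun t => by simp [hM, hL])
    have h2 := log_increment_unique (L := fun t => M (t, 1)) (L' := L l i j hij hil.symm hjl.symm)
      (by fun_prop) (by fun_prop) 1 (fun t => by simp [hM, hL])
    have h3 := log_increment_unique (L := fun t => M (0, t)) (L' := L i k l hkl hik hil)
      (by fun_prop) (by fun_prop) (-1) (fun t => by simp [hM, hL])
    have h4 := log_increment_unique (L := fun t => M (1, t)) (L' := L j k l hkl hjk hjl)
      (by fun_prop) (by fun_prop) (-1) (fun t => by simp [hM, hL])
    rw [hn] at h1 h2 h3 h4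
    have hpi : (Real.pi * Complex.I : ℂ) ≠ 0 := by simp [Real.pi_ne_zero]
    have e1 := hae i l hil
    have e2 := hae i k hik
    have e3 := hae j l hjl
    have e4 := hae j k hjk
    have : (Real.pi * Complex.I : ℂ) * (2 * (n k i j hij hik.symm hjk.symm
        - n l i j hij hil.symm hjl.symm - n i k l hkl hik hil + n j k l hkl hjk hjl))
        = Real.pi * Complex.I * (e i l - e i k - e j l + e j k) := by
      linear_combination -h1 + h2 + h3 - h4 + e1 - e2 - e3 + e4
    exact_mod_cast mul_left_cancel₀ hpi this
  have q1 := main 0 1 2 3 (by decide) (by decide) (by decide) (by decide) (by decide) (by decide)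
  have q2 := main 0 2 1 3 (by decide) (by decide) (by decide) (by decide) (by decide) (by decide)
  have q3 := main 0 3 1 2 (by decide) (by decide) (by decide) (by decide) (by decide) (by decide)
  have q4 := main 0 1 2 4 (by decide) (by decide) (by decide) (by decide) (by decide) (by decide)
  have q5 := main 0 2 1 4 (by decide) (by decide) (by decide) (by decide) (by decide) (by decide)
  have q6 := main 0 4 1 2 (by decide) (by decide) (by decide) (by decide) (by decide) (by decide)
  have q7 := main 0 1 3 4 (by decide) (by decide) (by decide) (by decide) (by decide) (by decide)
  have q8 := main 0 3 1 4 (by decide) (by decide) (by decide) (by decide) (by decide) (by decide)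
  have q9 := main 0 4 1 3 (by decide) (by decide) (by decide) (by decide) (by decide) (by decide)
  have q10 := main 0 2 3 4 (by decide) (by decide) (by decide) (by decide) (by decide) (by decide)
  have q11 := main 0 3 2 4 (by decide) (by decide) (by decide) (by decide) (by decide) (by decide)
  have q12 := main 0 4 2 3 (by decide) (by decide) (by decide) (by decide) (by decide) (by decide)
  have q13 := main 1 2 3 4 (by decide) (by decide) (by decide) (by decide) (by decide) (by decide)
  have q14 := main 1 3 2 4 (by decide) (by decide) (by decide) (by decide) (by decide) (by decide)
  have q15 := main 1 4 2 3 (by decide) (by decide) (by decide) (by decide) (by decide) (by decide)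
  simp only [e, Fin.reduceLT, if_true, if_false] at *
  omega

end

/-- A drawing of `G` in the plane in which only disjoint edges are required to be drawn disjointly;
edges are drawn as arbitrary sets joining their endpoints. -/
def SimpleGraph.WeaklyDrawable {V : Type*} (G : SimpleGraph V) : Prop :=
  ∃ (p : V → ℂ) (T : V → V → Set ℂ), (∀ u v, G.Adj u v → JoinedIn (T u v) (p u) (p v)) ∧
    ∀ a b c d, G.Adj a b → G.Adj c d → a ≠ c → a ≠ d → b ≠ c → b ≠ d → Disjoint (T a b) (T c d)

/-- The graph obtained from `G` by contracting the edge `uv` into `u`; the vertex `v` becomes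
isolated. -/
def SimpleGraph.contractInto {V : Type*} (G : SimpleGraph V) (u v : V) : SimpleGraph V where
  Adj a b := a ≠ b ∧ a ≠ v ∧ b ≠ v ∧ (G.Adj a b ∨ (a = u ∧ G.Adj v b) ∨ (b = u ∧ G.Adj a v))
  symm := ⟨by
    rintro a b ⟨hab, ha, hb, h⟩
    refine ⟨hab.symm, hb, ha, ?_⟩
    rcases h with h | ⟨h, h'⟩ | ⟨h, h'⟩
    · exact .inl h.symm
    · exact .inr (.inr ⟨h, h'.symm⟩)
    · exact .inr (.inl ⟨h, h'.symm⟩)⟩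
  loopless := ⟨fun a h => h.1 rfl⟩

namespace SimpleGraph.WeaklyDrawable

variable {V : Type*} {G H : SimpleGraph V}

theorem mono (hG : G.WeaklyDrawable) (h : H ≤ G) : H.WeaklyDrawable := by
  obtain ⟨p, T, hp, hT⟩ := hG
  exact ⟨p, T, fun u v huv => hp u v (h huv), fun a b c d hab hcd => hT a b c d (h hab) (h hcd)⟩

theorem contractInto (hG : G.WeaklyDrawable) {u v : V} (huv : G.Adj u v) :
    (G.contractInto u v).WeaklyDrawable := by
  classical
  obtain ⟨p, T, hp, hT⟩ := hG
  refine ⟨p, fun a b => if G.Adj a b then T a b else if a = u then T u v ∪ T v b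
    else T a v ∪ T v u, ?_, ?_⟩
  · rintro a b ⟨-, -, -, h⟩
    by_cases hab : G.Adj a b
    · simpa [hab] using hp a b hab
    · by_cases hau : a = u
      · subst hau
        have hvb : G.Adj v b := by
          rcases h with h | h | h
          · exact absurd h hab
          · exact h.2
          · exact h.1 ▸ huv.symm
        simp only [hab, if_true, if_false]
        exact ((hp _ _ huv).mono Set.subset_union_left).trans
          ((hp _ _ hvb).mono Set.subset_union_right)
      · have hb : b = u ∧ G.Adj a v := by tauto
        obtain ⟨rfl, hav⟩ := hb
        simp only [hab, hau, if_false]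
        exact ((hp _ _ hav).mono Set.subset_union_left).trans
          ((hp _ _ huv.symm).mono Set.subset_union_right)
  · rintro a b c d ⟨-, hav, hbv, h⟩ ⟨-, hcv, hdv, h'⟩ hac had hbc hbd
    have key : ∀ x y z w, x ≠ v → y ≠ v → z ≠ v → w ≠ v → x ≠ z → x ≠ w → y ≠ z → y ≠ w →
        G.Adj z w → (G.Adj x y ∨ (x = u ∧ G.Adj v y) ∨ (y = u ∧ G.Adj x v)) →
        Disjoint (if G.Adj x y then T x y else if x = u then T u v ∪ T v y
          else T x v ∪ T v u) (T z w) := by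
      intro x y z w hx hy hz hw hxz hxw hyz hyw hzw hxy
      split_ifs with h1 h2
      · exact hT _ _ _ _ h1 hzw hxz hxw hyz hyw
      · subst h2
        have hvy : G.Adj v y := by
          rcases hxy with h | h | h
          · exact absurd h h1
          · exact h.2
          · exact h.1 ▸ huv.symm
        exact Set.disjoint_union_left.2 ⟨hT _ _ _ _ huv hzw hxz hxw hz.symm hw.symm,
          hT _ _ _ _ hvy hzw hz.symm hw.symm hyz hyw⟩
      · have hb : y = u ∧ G.Adj x v := by tauto
        obtain ⟨rfl, hxv⟩ := hb
        exact Set.disjoint_union_left.2 ⟨hT _ _ _ _ hxv hzw hxz hxw hz.symm hw.symm,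
          hT _ _ _ _ huv.symm hzw hz.symm hw.symm hyz hyw⟩
    by_cases hcd : G.Adj c d
    · simpa only [hcd, if_true] using key a b c d hav hbv hcv hdv hac had hbc hbd hcd h
    · by_cases hab : G.Adj a b
      · simpa only [hab, if_true] using
          (key c d a b hcv hdv hav hbv hac.symm hbc.symm had.symm hbd.symm hab h').symm
      · exfalso
        have h1 : a = u ∨ b = u := by tauto
        have h2 : c = u ∨ d = u := by tauto
        rcases h1 with rfl | rfl <;> rcases h2 with rfl | rfl <;> contradiction

/-- A weakly drawable graph contains no complete graph on five vertices. -/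
theorem not_five_clique (hG : G.WeaklyDrawable) (q : Fin 5 → V)
    (hq : ∀ i j, i ≠ j → G.Adj (q i) (q j)) : False := by
  obtain ⟨p, T, hp, hT⟩ := hG
  choose γ hγ using fun i j hij => hp (q i) (q j) (hq i j hij)
  refine no_five_points (fun i => p (q i)) γ ?_
  intro i j k l hij hkl hik hil hjk hjl s t hst
  exact Set.disjoint_left.1 (hT _ _ _ _ (hq i j hij) (hq k l hkl) (hq i k hik).ne
    (hq i l hil).ne (hq j k hjk).ne (hq j l hjl).ne) (hγ i j hij s) (hst ▸ hγ k l hkl t)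

theorem not_five_adj (hG : G.WeaklyDrawable) {a b c d e : V} (hab : G.Adj a b) (hac : G.Adj a c)
    (had : G.Adj a d) (hae : G.Adj a e) (hbc : G.Adj b c) (hbd : G.Adj b d) (hbe : G.Adj b e)
    (hcd : G.Adj c d) (hce : G.Adj c e) (hde : G.Adj d e) : False := by
  refine hG.not_five_clique ![a, b, c, d, e] fun i j hij => ?_
  fin_cases i <;> fin_cases j <;>
    first | exact absurd rfl hij | assumption | exact SimpleGraph.Adj.symm ‹_›

end SimpleGraph.WeaklyDrawable

open Finset in
/-- Contracting an edge loses at most one more edge than the number of common neighbours. -/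
theorem SimpleGraph.card_edgeSet_le_contractInto {V : Type*} [Finite V] (G : SimpleGraph V)
    {u v : V} (huv : G.Adj u v) :
    G.edgeSet.ncard ≤ (G.contractInto u v).edgeSet.ncard + (G.commonNeighbors u v).ncard + 1 := by
  classical
  have := Fintype.ofFinite V
  let N : Finset V := univ.filter fun w => G.Adj v w ∧ w ≠ u ∧ ¬ G.Adj u w
  have h1 : (G.deleteIncidenceSet v).edgeFinset ∪ N.image (fun w => s(u, w))
      ⊆ (G.contractInto u v).edgeFinset := by
    intro e he
    induction e with | _ a b
    rw [mem_union] at he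
    rw [mem_edgeFinset, mem_edgeSet]
    rcases he with he | he
    · rw [mem_edgeFinset, mem_edgeSet, deleteIncidenceSet_adj] at he
      exact ⟨he.1.ne, he.2.1, he.2.2, .inl he.1⟩
    · obtain ⟨w, hw, hwe⟩ := mem_image.1 he
      simp only [N, mem_filter, mem_univ, true_and] at hw
      rw [← mem_edgeSet, ← hwe]
      exact ⟨hw.2.1.symm, huv.ne, hw.1.ne', .inr (.inl ⟨rfl, hw.1⟩)⟩
  have h2 : Disjoint (G.deleteIncidenceSet v).edgeFinset (N.image (fun w => s(u, w))) := by
    rw [Finset.disjoint_left]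
    intro e he he'
    obtain ⟨w, hw, rfl⟩ := mem_image.1 he'
    simp only [N, mem_filter, mem_univ, true_and] at hw
    rw [mem_edgeFinset, mem_edgeSet, deleteIncidenceSet_adj] at he
    exact hw.2.2 he.1
  have h3 : #(N.image (fun w => s(u, w))) = #N :=
    card_image_of_injective _ (fun a b h => Sym2.congr_right.1 h)
  have h4 : G.degree v ≤ #N + #(G.commonNeighbors u v).toFinset + 1 := by
    have : G.neighborFinset v ⊆ N ∪ (G.commonNeighbors u v).toFinset ∪ {u} := by
      intro w hw
      simp only [N, mem_union, mem_filter, mem_univ, true_and, Set.mem_toFinset,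
        mem_commonNeighbors, mem_singleton, mem_neighborFinset] at hw ⊢
      tauto
    calc G.degree v ≤ _ := card_le_card this
      _ ≤ _ := (card_union_le _ _).trans (by
        have := card_union_le N (G.commonNeighbors u v).toFinset
        simpa using this)
  have h5 := card_le_card h1
  rw [card_union_of_disjoint h2, h3, card_edgeFinset_deleteIncidenceSet] at h5
  rw [Set.ncard_eq_toFinset_card', Set.ncard_eq_toFinset_card', Set.ncard_eq_toFinset_card']
  change #G.edgeFinset ≤ #(G.contractInto u v).edgeFinset + _ + 1
  omega

namespace SimpleGraph.WeaklyDrawable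

variable {V : Type*} {G : SimpleGraph V}

/-- Contracting the edge `xa` of the configuration below would produce a complete graph on five
vertices. -/
theorem not_wheel (hG : G.WeaklyDrawable) {v x y a b c : V} (hvx : G.Adj v x) (hvy : G.Adj v y)
    (hva : G.Adj v a) (hvb : G.Adj v b) (hvc : G.Adj v c) (hxa : G.Adj x a) (hxb : G.Adj x b)
    (hxc : G.Adj x c) (hya : G.Adj y a) (hyb : G.Adj y b) (hyc : G.Adj y c) (hbc : G.Adj b c)
    (hab : a ≠ b) (hac : a ≠ c) (hxy : x ≠ y) : False := by
  have lift : ∀ s t, G.Adj s t → s ≠ a → t ≠ a → (G.contractInto x a).Adj s t :=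
    fun s t h hs ht => ⟨h.ne, hs, ht, .inl h⟩
  exact (hG.contractInto hxa).not_five_adj (lift _ _ hvx hva.ne hxa.ne)
    (lift _ _ hvy hva.ne hya.ne) (lift _ _ hvb hva.ne hab.symm) (lift _ _ hvc hva.ne hac.symm)
    ⟨hxy, hxa.ne, hya.ne, .inr (.inl ⟨rfl, hya.symm⟩)⟩ (lift _ _ hxb hxa.ne hab.symm)
    (lift _ _ hxc hxa.ne hac.symm) (lift _ _ hyb hya.ne hab.symm) (lift _ _ hyc hya.ne hac.symm)
    (lift _ _ hbc hab.symm hac.symm)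

open Finset

/-- In a weakly drawable graph, a vertex of degree four or five lies on an edge that is contained
in at most two triangles. -/
theorem exists_card_commonNeighbors_le [Finite V] (hG : G.WeaklyDrawable) {v : V}
    (h4 : 4 ≤ (G.neighborSet v).ncard) (h5 : (G.neighborSet v).ncard ≤ 5) :
    ∃ w, G.Adj v w ∧ (G.commonNeighbors v w).ncard ≤ 2 := by
  classical
  have := Fintype.ofFinite V
  by_contra! hcon
  rw [Set.ncard_eq_toFinset_card'] at h4 h5
  set N := (G.neighborSet v).toFinset with hN
  have hmem : ∀ w, w ∈ N ↔ G.Adj v w := fun w => by simp [hN]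
  have hfew : ∀ w ∈ N, #(N.filter fun x => x ≠ w ∧ ¬ G.Adj w x) + 4 ≤ #N := by
    intro w hw
    have h := hcon w ((hmem w).1 hw)
    rw [Set.ncard_eq_toFinset_card'] at h
    have hd : Disjoint (N.filter fun x => x ≠ w ∧ ¬ G.Adj w x)
        (insert w (G.commonNeighbors v w).toFinset) := by
      rw [Finset.disjoint_left]
      intro x hx hx'
      simp only [mem_filter, mem_insert, Set.mem_toFinset, mem_commonNeighbors] at hx hx'
      tauto
    have hs : (N.filter fun x => x ≠ w ∧ ¬ G.Adj w x) ∪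
        (insert w (G.commonNeighbors v w).toFinset) ⊆ N := by
      intro x hx
      simp only [mem_union, mem_filter, mem_insert, Set.mem_toFinset, mem_commonNeighbors] at hx
      rcases hx with hx | rfl | hx
      · exact hx.1
      · exact hw
      · exact (hmem x).2 hx.1
    have := card_le_card hs
    rw [card_union_of_disjoint hd, card_insert_of_notMem (by simp [mem_commonNeighbors])] at this
    omega
  by_cases hall : ∀ x ∈ N, ∀ y ∈ N, x ≠ y → G.Adj x y
  · obtain ⟨M, hM, hMc⟩ := exists_subset_card_eq h4
    obtain ⟨a, b, c, d, hab, hac, had, hbc, hbd, hcd, rfl⟩ := card_eq_four.1 hMc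
    have ha := hM (show a ∈ _ by simp)
    have hb := hM (show b ∈ _ by simp)
    have hc := hM (show c ∈ _ by simp)
    have hd := hM (show d ∈ _ by simp)
    exact hG.not_five_adj ((hmem a).1 ha) ((hmem b).1 hb) ((hmem c).1 hc) ((hmem d).1 hd)
      (hall _ ha _ hb hab) (hall _ ha _ hc hac) (hall _ ha _ hd had) (hall _ hb _ hc hbc)
      (hall _ hb _ hd hbd) (hall _ hc _ hd hcd)
  · push Not at hall
    obtain ⟨x, hx, y, hy, hxy, hnxy⟩ := hall
    have huniq : ∀ w ∈ N, ∀ s ∈ N, ∀ t ∈ N, s ≠ w → t ≠ w → s ≠ t → ¬ G.Adj w s → G.Adj w t := by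
      intro w hw s hs t ht hsw htw hst hns
      by_contra hnt
      have h1 : #(N.filter fun x => x ≠ w ∧ ¬ G.Adj w x) ≤ 1 := by
        have := hfew w hw; omega
      exact hst (card_le_one.1 h1 s (by simp [hs, hsw, hns]) t (by simp [ht, htw, hnt]))
    have hcard : #N = 5 := by
      have h1 : 0 < #(N.filter fun z => z ≠ x ∧ ¬ G.Adj x z) :=
        card_pos.2 ⟨y, by simp [hy, hxy.symm, hnxy]⟩
      have := hfew x hx
      omega
    have hcard3 : #((N.erase x).erase y) = 3 := by
      rw [card_erase_of_mem (by simp [hy, hxy.symm]), card_erase_of_mem hx, hcard]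
    obtain ⟨a, b, c, hab, hac, hbc, habc⟩ := card_eq_three.1 hcard3
    have hm : ∀ z, z ∈ (N.erase x).erase y → z ∈ N ∧ G.Adj x z ∧ G.Adj y z := by
      intro z hz
      simp only [mem_erase] at hz
      exact ⟨hz.2.2, huniq x hx y hy z hz.2.2 hxy.symm hz.2.1 hz.1.symm hnxy,
        huniq y hy x hx z hz.2.2 hxy hz.1 hz.2.1.symm fun h => hnxy h.symm⟩
    obtain ⟨ha, hxa, hya⟩ := hm a (by simp [habc])
    obtain ⟨hb, hxb, hyb⟩ := hm b (by simp [habc])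
    obtain ⟨hc, hxc, hyc⟩ := hm c (by simp [habc])
    rw [hmem] at hx hy
    have hva := (hmem a).1 ha
    have hvb := (hmem b).1 hb
    have hvc := (hmem c).1 hc
    by_cases h : G.Adj a b
    · exact hG.not_wheel hx hy hvc hva hvb hxc hxa hxb hyc hya hyb h hac.symm hbc.symm hxy
    · exact hG.not_wheel hx hy hvb hva hvc hxb hxa hxc hyb hya hyc
        (huniq a ha b hb c hc hab.symm hac.symm hbc h) hab.symm hbc hxy

/-- The edge bound of planar graphs holds for weakly drawable graphs. -/
theorem card_edgeSet_add_six_le [Finite V] (hG : G.WeaklyDrawable) (S : Finset V)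
    (hS : ∀ u v, G.Adj u v → u ∈ S) (h3 : 3 ≤ #S) : G.edgeSet.ncard + 6 ≤ 3 * #S := by
  classical
  have := Fintype.ofFinite V
  induction hn : #S generalizing G S with
  | zero => omega
  | succ m ih =>
  by_contra! hcon
  obtain ⟨t, ht, htc⟩ := Set.exists_subset_card_eq (s := G.edgeSet) (n := 3 * (m + 1) - 5)
    (by omega)
  obtain ⟨H, hHt⟩ : ∃ H : SimpleGraph V, H.edgeSet = t := by
    refine ⟨fromEdgeSet t, ?_⟩
    rw [edgeSet_fromEdgeSet, sdiff_eq_left]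
    exact Set.disjoint_left.2 fun e he he' => G.not_isDiag_of_mem_edgeSet (ht he) he'
  have hHG : H ≤ G := edgeSet_subset_edgeSet.1 (hHt ▸ ht)
  have hH := hG.mono hHG
  have hHS : ∀ u v, H.Adj u v → u ∈ S := fun u v h => hS u v (hHG h)
  have hHc : #H.edgeFinset = 3 * (m + 1) - 5 := by
    rw [← htc, ← hHt, Set.ncard_eq_toFinset_card']; rfl
  have hsum : ∑ v ∈ S, H.degree v = 2 * #H.edgeFinset := by
    rw [← sum_degrees_eq_twice_card_edges]
    refine sum_subset (subset_univ _) fun v _ hv => ?_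
    by_contra h
    obtain ⟨w, hw⟩ := (degree_pos_iff_exists_adj H v).1 (Nat.pos_of_ne_zero h)
    exact hv (hHS _ _ hw)
  by_cases hm : m = 2
  · have : ∑ v ∈ S, H.degree v ≤ #S • 2 := sum_le_card_nsmul _ _ _ fun v hv => by
      have hsub : H.neighborFinset v ⊆ S.erase v := by
        intro w hw
        rw [mem_neighborFinset] at hw
        exact mem_erase.2 ⟨hw.ne', hHS _ _ hw.symm⟩
      have := card_le_card hsub
      rw [card_erase_of_mem hv, card_neighborFinset_eq_degree] at this
      omega
    rw [smul_eq_mul] at this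
    omega
  obtain ⟨v, hv, hv5⟩ : ∃ v ∈ S, H.degree v ≤ 5 := by
    by_contra! h
    have := card_nsmul_le_sum S (fun v => H.degree v) 6 (fun v hv => h v hv)
    rw [smul_eq_mul] at this
    omega
  have herase : ∀ v ∈ S, #(S.erase v) = m := fun v hv => by rw [card_erase_of_mem hv, hn]; rfl
  have hdeg : (H.neighborSet v).ncard = H.degree v := by
    rw [Set.ncard_eq_toFinset_card']; rfl
  by_cases hv3 : H.degree v ≤ 3
  · have := ih (hH.mono (H.deleteIncidenceSet_le v)) (S.erase v) (fun a b h => by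
      rw [deleteIncidenceSet_adj] at h
      exact mem_erase.2 ⟨h.2.1, hHS _ _ h.1⟩) (by rw [herase v hv]; omega) (herase v hv)
    rw [Set.ncard_eq_toFinset_card'] at this
    change #(H.deleteIncidenceSet v).edgeFinset + 6 ≤ _ at this
    rw [card_edgeFinset_deleteIncidenceSet] at this
    have := H.degree_le_card_edgeFinset v
    omega
  · obtain ⟨w, hvw, hw⟩ := hH.exists_card_commonNeighbors_le (v := v) (by omega) (by omega)
    have h1 := H.card_edgeSet_le_contractInto hvw
    have hwS := hHS _ _ hvw.symm
    have := ih (hH.contractInto hvw) (S.erase w) (fun a b h => by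
      refine mem_erase.2 ⟨h.2.1, ?_⟩
      rcases h.2.2.2 with h | h | h
      · exact hHS _ _ h
      · exact h.1 ▸ hv
      · exact hHS _ _ h.2) (by rw [herase w hwS]; omega) (herase w hwS)
    rw [hHt, htc] at h1
    omega

/-- A weakly drawable graph with an edge has a non-isolated vertex of degree at most five. -/
theorem exists_degree_le_five [Fintype V] [DecidableRel G.Adj] (hG : G.WeaklyDrawable)
    (h0 : G ≠ ⊥) : ∃ v, 0 < G.degree v ∧ G.degree v ≤ 5 := by
  classical
  by_contra! hcon
  obtain ⟨u, v, huv⟩ := ne_bot_iff_exists_adj.1 h0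
  let S : Finset V := univ.filter fun v => 0 < G.degree v
  have hS : ∀ u v, G.Adj u v → u ∈ S := fun u v h => by
    simpa [S, degree_pos_iff_exists_adj] using ⟨v, h⟩
  have h6 : ∀ v ∈ S, 6 ≤ G.degree v := fun v hv => hcon v (by simpa [S] using hv)
  have hcard : 6 ≤ #S := (h6 u (hS u v huv)).trans <| card_le_card fun w hw =>
    hS w u ((mem_neighborFinset _ _ _).1 hw).symm
  have h1 := hG.card_edgeSet_add_six_le S hS (by omega)
  rw [Set.ncard_eq_toFinset_card'] at h1
  change #G.edgeFinset + 6 ≤ _ at h1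
  have h2 := card_nsmul_le_sum S (fun v => G.degree v) 6 h6
  have h3 : ∑ v ∈ S, G.degree v ≤ ∑ v, G.degree v := sum_le_sum_of_subset (subset_univ _)
  rw [sum_degrees_eq_twice_card_edges] at h3
  rw [smul_eq_mul] at h2
  omega

end SimpleGraph.WeaklyDrawable

/-- Topologically planar graphs are weakly drawable. -/
theorem Planar.weaklyDrawable {V : Type*} {G : SimpleGraph V} (hG : Planar G) :
    G.WeaklyDrawable := by
  classical
  obtain ⟨f, arc, hf, hcont, -, hends, -, hvert, hcross⟩ := hG
  let φ := Complex.equivRealProdCLM.symm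
  refine ⟨fun v => φ (f v),
    fun u v => if h : G.Adj u v then φ '' Set.range (arc ⟨(u, v), h⟩) else ∅, ?_, ?_⟩
  · intro u v h
    simp only [h, dif_pos]
    refine ⟨⟨⟨fun t => φ (arc ⟨(u, v), h⟩ t), φ.continuous.comp (hcont _)⟩,
      congrArg φ (hends ⟨(u, v), h⟩).1, congrArg φ (hends ⟨(u, v), h⟩).2⟩,
      fun t => ⟨_, ⟨t, rfl⟩, rfl⟩⟩
  · intro a b c d hab hcd hac had hbc hbd
    simp only [hab, hcd, dif_pos]
    rw [Set.disjoint_image_iff φ.injective, Set.disjoint_left]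
    intro x hx hx'
    have hne : (⟨(a, b), hab⟩ : G.Dart).edge ≠ (⟨(c, d), hcd⟩ : G.Dart).edge := by
      intro h
      have : s(a, b) = s(c, d) := h
      rw [Sym2.eq_iff] at this
      tauto
    obtain ⟨v, rfl⟩ := hcross _ _ hne ⟨hx, hx'⟩
    have h1 : v = a ∨ v = b := hvert _ v hx
    have h2 : v = c ∨ v = d := hvert _ v hx'
    rcases h1 with rfl | rfl <;> rcases h2 with rfl | rfl <;> contradiction

open Finset in
/-- An incidence coloring of the graph without the vertex `v` of small degree extends to the whole
graph. -/
theorem HasIncColoring.of_deleteIncidenceSet {V : Type*} [Fintype V] {G : SimpleGraph V}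
    [DecidableRel G.Adj] {D k m : ℕ} (hm : D + 2 * k ≤ m + 1) (hD : ∀ u, G.degree u ≤ D) {v : V}
    (hv : G.degree v ≤ k) (h : HasIncColoring (G.deleteIncidenceSet v) m k) :
    HasIncColoring G m k := by
  classical
  obtain ⟨c, hc, hck⟩ := h
  have hdel : ∀ x y, G.Adj x y → x ≠ v → y ≠ v → (G.deleteIncidenceSet v).Adj x y :=
    fun x y h hx hy => SimpleGraph.deleteIncidenceSet_adj.2 ⟨h, hx, hy⟩
  generalize hH : G.deleteIncidenceSet v = H at *
  have hHG : ∀ x y, H.Adj x y → G.Adj x y ∧ x ≠ v ∧ y ≠ v := fun x y h => by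
    rwa [← hH, SimpleGraph.deleteIncidenceSet_adj] at h
  let inc : V → Finset (Fin m) := fun u => (univ.filter fun w => H.Adj w u).image fun w => c w u
  let out : V → Finset (Fin m) := fun u => (univ.filter fun w => H.Adj u w).image fun w => c u w
  have hinc : ∀ u, #(inc u) ≤ k := by
    intro u
    rw [← Set.ncard_coe_finset]
    convert hck u using 2
    ext x
    simp [inc]
  have hout : ∀ u, G.Adj v u → #(out u) + 1 ≤ D := by
    intro u hu
    have h1 : #(out u) ≤ #((G.neighborFinset u).erase v) :=
      card_image_le.trans <| card_le_card fun w hw => by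
        simp only [mem_filter, mem_univ, true_and] at hw
        simp [(hHG _ _ hw).1, (hHG _ _ hw).2.2]
    have h2 : v ∈ G.neighborFinset u := by simpa using hu.symm
    have h3 := card_erase_add_one h2
    rw [SimpleGraph.card_neighborFinset_eq_degree] at h3
    have := hD u
    omega
  have hdisj : ∀ u, Disjoint (inc u) (out u) := by
    intro u
    rw [Finset.disjoint_left]
    intro x hx hx'
    simp only [inc, out, mem_image, mem_filter, mem_univ, true_and] at hx hx'
    obtain ⟨w, hw, rfl⟩ := hx
    obtain ⟨w', hw', he⟩ := hx'
    exact hc w u u w' hw hw' (fun h => hw.ne (Prod.ext_iff.1 h).1) (.inr (.inl rfl)) he.symm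
  -- The lists from which the incidences at `v` are colored
  let L : V → Finset (Fin m) := fun u => if #(inc u) = k then inc u else univ \ out u
  have hL : ∀ u, G.Adj v u → k ≤ #(L u) := by
    intro u hu
    simp only [L]
    split_ifs with h
    · exact h.ge
    · have := hout u hu
      rw [card_univ_sdiff, Fintype.card_fin]
      omega
  have hLout : ∀ u, ∀ x ∈ L u, x ∉ out u := by
    intro u x hx
    simp only [L] at hx
    split_ifs at hx with h
    · exact Finset.disjoint_left.1 (hdisj u) hx
    · exact (mem_sdiff.1 hx).2
  have hLinc : ∀ u, ∀ x ∈ L u, #(insert x (inc u)) ≤ k := by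
    intro u x hx
    simp only [L] at hx
    split_ifs at hx with h
    · rw [insert_eq_of_mem hx]; exact hinc u
    · have := card_insert_le x (inc u)
      have := hinc u
      omega
  have hdeg : Fintype.card {w // G.Adj v w} = G.degree v := by
    rw [← SimpleGraph.card_neighborSet_eq_degree]; rfl
  obtain ⟨a', ha'inj, ha'L⟩ :=
    (all_card_le_biUnion_card_iff_exists_injective fun u : {w // G.Adj v w} => L u).1 (by
      intro s
      rcases s.eq_empty_or_nonempty with rfl | ⟨u, hu⟩
      · simp
      · calc #s ≤ _ := card_le_univ s
          _ ≤ k := hdeg.trans_le hv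
          _ ≤ _ := hL u u.2
          _ ≤ _ := card_le_card (subset_biUnion_of_mem (fun u : {w // G.Adj v w} => L u) hu))
  obtain ⟨a, hainj, haL⟩ : ∃ a : V → Fin m,
      (∀ x y, G.Adj v x → G.Adj v y → a x = a y → x = y) ∧ ∀ x, G.Adj v x → a x ∈ L x := by
    refine ⟨fun w => if h : G.Adj v w then a' ⟨w, h⟩ else c v w, ?_, ?_⟩
    · intro x y hx hy h
      simp only [hx, hy, dif_pos] at h
      exact congrArg Subtype.val (ha'inj h)
    · intro x hx
      simp only [hx, dif_pos]
      exact ha'L ⟨x, hx⟩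
  have hb : ∀ u, ∃ β : Fin m, G.Adj v u →
      β ∉ out u ∧ β ∉ inc u ∧ ∀ w, G.Adj v w → β ≠ a w := by
    intro u
    by_cases hu : G.Adj v u
    · let A := (G.neighborFinset v).image a
      have hauA : a u ∈ A := mem_image_of_mem a (by simpa using hu)
      have hA : #(A.erase (a u)) + 1 ≤ k := by
        rw [card_erase_add_one hauA]
        exact card_image_le.trans (by simpa using hv)
      have hlt : #(out u ∪ insert (a u) (inc u) ∪ A.erase (a u)) < #(univ : Finset (Fin m)) := by
        have h1 := card_union_le (out u ∪ insert (a u) (inc u)) (A.erase (a u))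
        have h2 := card_union_le (out u) (insert (a u) (inc u))
        have h3 := hLinc u _ (haL u hu)
        have h4 := hout u hu
        rw [card_univ, Fintype.card_fin]
        omega
      obtain ⟨β, -, hβ⟩ := exists_mem_notMem_of_card_lt_card hlt
      simp only [mem_union, mem_insert, mem_erase, not_or] at hβ
      refine ⟨β, fun _ => ⟨hβ.1.1, hβ.1.2.2, fun w hw h => hβ.2 ⟨hβ.1.2.1, ?_⟩⟩⟩
      exact h ▸ mem_image_of_mem a (by simpa using hw)
    · exact ⟨c v u, fun h => absurd h hu⟩
  choose b hb using hb
  have hmemout : ∀ x y, H.Adj x y → c x y ∈ out x := fun x y h =>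
    mem_image_of_mem (fun w => c x w) (by simpa using h)
  have hmeminc : ∀ x y, H.Adj x y → c x y ∈ inc y := fun x y h =>
    mem_image_of_mem (fun w => c w y) (by simpa using h)
  refine ⟨fun x y => if x = v then a y else if y = v then b x else c x y, ?_, ?_⟩
  · intro x y x' y' h h' hne hconf
    by_cases hx : x = v
    · subst hx
      by_cases hx' : x' = x
      · subst hx'
        simp only [if_true]
        exact fun he => hne (by rw [hainj y y' h h' he])
      · by_cases hy' : y' = x
        · subst hy'
          simp only [if_true, hx', if_false]
          exact ((hb x' h'.symm).2.2 y h).symm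
        · obtain rfl : y = x' := by tauto
          simp only [if_true, hx', hy', if_false]
          exact fun he => hLout y _ (haL y h) (he ▸ hmemout _ _ (hdel _ _ h' hx' hy'))
    · by_cases hy : y = v
      · subst hy
        by_cases hx' : x' = y
        · subst hx'
          simp only [if_true, hx, if_false]
          exact (hb x h.symm).2.2 y' h'
        · by_cases hy' : y' = y
          · subst hy'
            exact absurd (by rcases hconf with h | h | h <;> grind) hne
          · simp only [if_true, hx, hx', hy', if_false]
            have hH' := hdel _ _ h' hx' hy'
            rcases hconf with rfl | rfl | rfl
            · exact fun he => (hb x h.symm).1 (he ▸ hmemout _ _ hH')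
            · exact absurd rfl hx'
            · exact fun he => (hb x h.symm).2.1 (he ▸ hmeminc _ _ hH')
      · have hH' := hdel _ _ h hx hy
        by_cases hx' : x' = v
        · subst hx'
          obtain rfl : y' = x := by tauto
          simp only [if_true, hx, hy, if_false]
          exact fun he => hLout _ _ (haL _ h') (he ▸ hmemout _ _ hH')
        · by_cases hy' : y' = v
          · subst hy'
            simp only [if_true, hx, hx', hy, if_false]
            rcases hconf with rfl | rfl | rfl
            · exact fun he => (hb x h'.symm).1 (he ▸ hmemout _ _ hH')
            · exact fun he => (hb y h'.symm).2.1 (he ▸ hmeminc _ _ hH')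
            · exact absurd rfl hx
          · simp only [hx, hy, hx', hy', if_false]
            exact hc x y x' y' hH' (hdel _ _ h' hx' hy') hne hconf
  · intro z
    by_cases hz : z = v
    · subst hz
      refine le_trans ?_ ((card_image_le (s := G.neighborFinset z) (f := b)).trans (by simpa using hv))
      rw [← Set.ncard_coe_finset]
      refine Set.ncard_le_ncard ?_ (Finset.finite_toSet _)
      rintro x ⟨u, hu, rfl⟩
      simp only [hu.ne, if_true, if_false]
      exact mem_coe.2 (mem_image_of_mem b (by simpa using hu.symm))
    · by_cases hvz : G.Adj v z
      · refine le_trans ?_ (hLinc z _ (haL z hvz))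
        rw [← Set.ncard_coe_finset]
        refine Set.ncard_le_ncard ?_ (Finset.finite_toSet _)
        rintro x ⟨u, hu, rfl⟩
        rw [mem_coe, mem_insert]
        by_cases huv : u = v
        · simp [huv]
        · simp only [huv, hz, if_false]
          exact .inr (hmeminc _ _ (hdel _ _ hu huv hz))
      · refine le_trans ?_ (hinc z)
        rw [← Set.ncard_coe_finset]
        refine Set.ncard_le_ncard ?_ (Finset.finite_toSet _)
        rintro x ⟨u, hu, rfl⟩
        have huv : u ≠ v := by rintro rfl; exact hvz hu
        simp only [huv, hz, if_false]
        exact hmeminc _ _ (hdel _ _ hu huv hz)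

/-- Weakly drawable graphs of maximum degree at most `D` have a `(D + 9, 5)`-incidence coloring. -/
theorem SimpleGraph.WeaklyDrawable.hasIncColoring {V : Type*} [Fintype V] {G : SimpleGraph V}
    [DecidableRel G.Adj] (hG : G.WeaklyDrawable) {D : ℕ} (hD : ∀ u, G.degree u ≤ D) :
    HasIncColoring G (D + 9) 5 := by
  classical
  induction hn : G.edgeFinset.card using Nat.strong_induction_on generalizing G with
  | _ n ih =>
  by_cases h0 : G = ⊥
  · subst h0
    exact ⟨fun _ _ => 0, fun _ _ _ _ h => absurd h (by simp), fun v => by simp⟩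
  obtain ⟨v, hv0, hv5⟩ := hG.exists_degree_le_five h0
  refine HasIncColoring.of_deleteIncidenceSet (by omega) hD hv5 (ih _ ?_
    (hG.mono (G.deleteIncidenceSet_le v)) (fun u => ?_) rfl)
  · rw [card_edgeFinset_deleteIncidenceSet]
    have := G.degree_le_card_edgeFinset v
    omega
  · exact (degree_le_of_le (G.deleteIncidenceSet_le v)).trans (hD u)

/-- Every simple planar graph has incidence chromatic number at most Δ + 9. -/
theorem stmt_15 {V : Type*} [Fintype V] (G : SimpleGraph V) [DecidableRel G.Adj]
    (hplanar : Planar G) : HasProperIncColoring G (G.maxDegree + 9) := by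
  obtain ⟨c, hc, -⟩ := hplanar.weaklyDrawable.hasIncColoring G.degree_le_maxDegree
  exact ⟨c, hc⟩
end
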